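/- Let H = (V, E) be a d-regular graph on n vertices with d ≥ 1000. Suppose that for every set W of w vertices with w ≤ n/2 such that the subgraph of H induced on W is connected, there are at least w(8 log d + 2) edges of H connecting W to its complement. Then there exist a spanning subgraph H' = (V, E') of H in which every vertex has degree at least d − 3 log d − 2, and an assignment of a vector v(e) ∈ (ℤ/2)^d to every edge e ∈ E', such that: (1) for every vertex u ∈ V, the set of vectors assigned to the edges of H' incident with u is linearly independent; and (2) for every integer w with 2 ≤ w ≤ n/2 and every set W of w vertices such that the subgraph of H induced on W is connected, the set of vectors assigned to the edges of H' connecting W to its complement spans (ℤ/2)^d. -/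

import Mathlib

open SimpleGraph

/-- A collection `𝒢` of spanning subgraphs of `H` is a *connectivity code* for `H` if the
symmetric difference of any two distinct members of `𝒢` is a connected (spanning) subgraph
of `H`. -/
def IsConnCode {V : Type*} (H : SimpleGraph V) (𝒢 : Set (SimpleGraph V)) : Prop :=
  (∀ G ∈ 𝒢, G ≤ H) ∧
    ∀ G₁ ∈ 𝒢, ∀ G₂ ∈ 𝒢, G₁ ≠ G₂ → (symmDiff G₁ G₂).Connected

/-- `mCode H` is the maximum possible cardinality of a connectivity code for `H`. -/
noncomputable def mCode {V : Type*} [Fintype V] (H : SimpleGraph V) : ℕ :=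
  sSup {n : ℕ | ∃ 𝒢 : Set (SimpleGraph V), IsConnCode H 𝒢 ∧ 𝒢.ncard = n}

/-- The set of edges of `H` with one endpoint in `W` and the other in its complement. -/
def cutEdgeSet {V : Type*} (H : SimpleGraph V) (W : Set V) : Set (Sym2 V) :=
  {e | e ∈ H.edgeSet ∧ ∃ x ∈ W, ∃ y ∈ Wᶜ, e = s(x, y)}

/-- The edge-connectivity of `H`: the minimum number of edges whose deletion disconnects `H`. -/
noncomputable def edgeConn {V : Type*} [Fintype V] (H : SimpleGraph V) : ℕ :=
  sInf {n : ℕ | ∃ F : Set (Sym2 V), F ⊆ H.edgeSet ∧ F.ncard = n ∧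
    ¬(H.deleteEdges F).Connected}

/-- Swapping the coordinates outside `D` shows that events determined by complementary sets of
coordinates are independent. -/
theorem card_filter_and_mul_card_of_dependsOn {E S : Type*} [Fintype E] [Fintype S]
    [DecidableEq E] (D : Set E) (P Q : (E → S) → Prop) [DecidablePred P] [DecidablePred Q]
    (hP : ∀ f g : E → S, (∀ e ∈ D, f e = g e) → P f → P g)
    (hQ : ∀ f g : E → S, (∀ e ∉ D, f e = g e) → Q f → Q g) :
    (Finset.univ.filter fun f => P f ∧ Q f).card * Fintype.card (E → S) =
      (Finset.univ.filter P).card * (Finset.univ.filter Q).card := by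
  classical
  rw [← Finset.card_univ, ← Finset.card_product, ← Finset.card_product]
  let φ : (E → S) × (E → S) → (E → S) × (E → S) := fun p =>
    (D.piecewise p.1 p.2, D.piecewise p.2 p.1)
  have hφ : ∀ p, φ (φ p) = p := by
    rintro ⟨f, g⟩
    ext e <;> by_cases he : e ∈ D <;> simp [φ, he]
  refine Finset.card_bij' (fun p _ => φ p) (fun p _ => φ p) ?_ ?_ (fun p _ => hφ p)
    (fun p _ => hφ p)
  · rintro ⟨f, g⟩ h
    simp only [Finset.mem_product, Finset.mem_filter, Finset.mem_univ, true_and, and_true] at h ⊢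
    exact ⟨hP f _ (fun e he => by simp [φ, he]) h.1, hQ f _ (fun e he => by simp [φ, he]) h.2⟩
  · rintro ⟨f, g⟩ h
    simp only [Finset.mem_product, Finset.mem_filter, Finset.mem_univ, true_and, and_true] at h ⊢
    exact ⟨hP f _ (fun e he => by simp [φ, he]) h.1, hQ g _ (fun e he => by simp [φ, he]) h.2⟩

/-- The asymmetric Lovász local lemma for uniformly random functions: `A i` is a bad event
determined by the coordinates in `D i`. -/
theorem lovasz_local_lemma {E S ι : Type*} [Fintype E] [DecidableEq E] [Fintype S]
    [Nonempty S] (J : Finset ι) (A : ι → (E → S) → Prop) [∀ i, DecidablePred (A i)]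
    (D : ι → Set E)
    [∀ i, DecidablePred fun j => ¬ Disjoint (D i) (D j)]
    (hA : ∀ i ∈ J, ∀ f g : E → S, (∀ e ∈ D i, f e = g e) → A i f → A i g)
    (x : ι → ℝ) (hx0 : ∀ i ∈ J, 0 ≤ x i) (hx1 : ∀ i ∈ J, x i < 1)
    (hprob : ∀ i ∈ J, ((Finset.univ.filter (A i)).card : ℝ) ≤
      x i * (∏ j ∈ J with ¬ Disjoint (D i) (D j), (1 - x j)) * Fintype.card (E → S)) :
    ∃ f, ∀ i ∈ J, ¬ A i f := by
  classical
  let N : Finset ι → Finset (E → S) := fun T => Finset.univ.filter fun f => ∀ j ∈ T, ¬ A j f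
  have hN : ∀ T f, f ∈ N T ↔ ∀ j ∈ T, ¬ A j f := by simp [N]
  have hinsert : ∀ i T, (N (insert i T)).card + ((N T).filter (A i)).card = (N T).card := by
    intro i T
    rw [← Finset.card_filter_add_card_filter_not (s := N T) (A i), add_comm]
    congr 2
    ext f
    simp [hN, and_comm]
  have hstep : ∀ i ∈ J, ∀ T, (((N T).filter (A i)).card : ℝ) ≤ x i * (N T).card →
      (1 - x i) * (N T).card ≤ (N (insert i T)).card := by
    intro i _ T h
    have := hinsert i T
    have : ((N (insert i T)).card : ℝ) + ((N T).filter (A i)).card = (N T).card := by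
      exact_mod_cast this
    linarith
  have key : ∀ n, ∀ T ⊆ J, T.card = n → ∀ i ∈ J,
      (((N T).filter (A i)).card : ℝ) ≤ x i * (N T).card := by
    intro n
    induction n using Nat.strong_induction_on with
    | _ n ih =>
    intro T hT hn i hi
    set T₁ := T.filter fun j => ¬ Disjoint (D i) (D j) with hT₁
    set T₂ := T.filter fun j => Disjoint (D i) (D j) with hT₂
    have hsplit : T₁ ∪ T₂ = T := by
      ext j; simp only [hT₁, hT₂, Finset.mem_union, Finset.mem_filter]; tauto
    have hdisj : Disjoint T₁ T₂ := by
      rw [Finset.disjoint_left]; intro j; simp only [hT₁, hT₂, Finset.mem_filter]; tauto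
    have hchain : ∀ U ⊆ T₁, (∏ j ∈ U, (1 - x j)) * (N T₂).card ≤ (N (U ∪ T₂)).card := by
      intro U
      induction U using Finset.induction_on with
      | empty => simp
      | insert a U ha ihU =>
        intro hU
        have haJ : a ∈ J := hT (hsplit ▸ Finset.mem_union_left _ (hU (Finset.mem_insert_self a U)))
        have hUT : U ⊆ T₁ := (Finset.subset_insert a U).trans hU
        have hsub : insert a (U ∪ T₂) ⊆ T := by
          rw [← Finset.insert_union, ← hsplit]
          exact Finset.union_subset_union_left hU
        have hnot : a ∉ U ∪ T₂ := by
          rw [Finset.mem_union, not_or]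
          exact ⟨ha, Finset.disjoint_left.1 hdisj (hU (Finset.mem_insert_self a U))⟩
        have hcard : (U ∪ T₂).card < n := by
          have := Finset.card_le_card hsub
          rw [Finset.card_insert_of_notMem hnot] at this
          omega
        have h1 := hstep a haJ _ (ih _ hcard _
          (((Finset.subset_insert _ _).trans hsub).trans hT) rfl a haJ)
        rw [Finset.prod_insert ha, Finset.insert_union, mul_assoc]
        exact (mul_le_mul_of_nonneg_left (ihU hUT) (by linarith [hx1 a haJ])).trans h1
    have hind : (((N T₂).filter (A i)).card : ℝ) * Fintype.card (E → S) =
        (Finset.univ.filter (A i)).card * (N T₂).card := by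
      have := card_filter_and_mul_card_of_dependsOn (D i) (A i) (fun f => ∀ j ∈ T₂, ¬ A j f)
        (hA i hi) (fun f g hfg h j hj hg => h j hj (hA j (hT (Finset.mem_filter.1 hj).1) g f
          (fun e he => (hfg e (Set.disjoint_right.1 (Finset.mem_filter.1 hj).2 he)).symm) hg))
      have h2 : (Finset.univ.filter fun f => A i f ∧ ∀ j ∈ T₂, ¬ A j f) = (N T₂).filter (A i) := by
        ext f; simp [hN, and_comm]
      rw [h2] at this
      exact_mod_cast this
    have hpos : (0 : ℝ) < Fintype.card (E → S) := by exact_mod_cast Fintype.card_pos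
    have hmono : (((N T).filter (A i)).card : ℝ) ≤ ((N T₂).filter (A i)).card := by
      have : (N T).filter (A i) ⊆ (N T₂).filter (A i) := by
        intro f
        simp only [Finset.mem_filter, hN]
        exact fun h => ⟨fun j hj => h.1 j (hsplit ▸ Finset.mem_union_right _ hj), h.2⟩
      exact_mod_cast Finset.card_le_card this
    have hprod : ∏ j ∈ J with ¬ Disjoint (D i) (D j), (1 - x j) ≤ ∏ j ∈ T₁, (1 - x j) := by
      have hsub : T₁ ⊆ J.filter fun j => ¬ Disjoint (D i) (D j) :=
        Finset.filter_subset_filter _ hT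
      apply Finset.prod_le_prod_of_subset_of_le_one hsub
      · exact fun j hj => by linarith [hx1 j (Finset.mem_filter.1 hj).1]
      · exact fun j hj _ => by linarith [hx0 j (Finset.mem_filter.1 hj).1]
    have hN2 : (((N T₂).filter (A i)).card : ℝ) ≤
        x i * (∏ j ∈ J with ¬ Disjoint (D i) (D j), (1 - x j)) * (N T₂).card := by
      refine le_of_mul_le_mul_right ?_ hpos
      rw [hind]
      calc _ ≤ _ := mul_le_mul_of_nonneg_right (hprob i hi) (Nat.cast_nonneg (N T₂).card)
        _ = _ := by ring
    have hc := hchain T₁ subset_rfl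
    rw [hsplit] at hc
    calc _ ≤ _ := hmono.trans hN2
      _ ≤ x i * ((∏ j ∈ T₁, (1 - x j)) * (N T₂).card) := by
        rw [mul_assoc]
        have := hx0 i hi
        gcongr
      _ ≤ _ := mul_le_mul_of_nonneg_left hc (hx0 i hi)
  have hfin : ∀ U ⊆ J, 0 < (N U).card := by
    intro U
    induction U using Finset.induction_on with
    | empty =>
      exact fun _ => Finset.card_pos.2 ⟨fun _ : E => Classical.arbitrary S, (hN ∅ _).2 (by simp)⟩
    | insert a U _ ih =>
      intro hU
      have haJ := hU (Finset.mem_insert_self a U)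
      have hUJ := (Finset.subset_insert a U).trans hU
      have h := hstep a haJ U (key _ U hUJ rfl a haJ)
      have h0 : (0 : ℝ) < (1 - x a) * (N U).card :=
        mul_pos (by linarith [hx1 a haJ]) (by exact_mod_cast ih hUJ)
      exact_mod_cast h0.trans_le h
  obtain ⟨f, hf⟩ := Finset.card_pos.1 (hfin J subset_rfl)
  exact ⟨f, (hN J f).1 hf⟩

/-- Thomassen's argument: a subgraph minimal among those with degrees `k + 1` and `k + 2` has no
edge between vertices of degree `k + 2`, so by Hall's theorem some matching covers them all. -/
theorem SimpleGraph.exists_le_ncard_neighborSet_pred {V : Type*} [Finite V] (G : SimpleGraph V)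
    (k : ℕ) (hG : ∀ v, (G.neighborSet v).ncard = k + 1 ∨ (G.neighborSet v).ncard = k + 2) :
    ∃ G' ≤ G, ∀ v, (G'.neighborSet v).ncard = k ∨ (G'.neighborSet v).ncard = k + 1 := by
  classical
  have := Fintype.ofFinite V
  obtain ⟨G₀, hle, hmin⟩ := (Set.toFinite {F : SimpleGraph V | ∀ v,
    (F.neighborSet v).ncard = k + 1 ∨ (F.neighborSet v).ncard = k + 2}).exists_le_minimal hG
  have hG₀ := hmin.prop
  have hdel : ∀ a b, G₀.Adj a b → (G₀.neighborSet a).ncard = k + 2 →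
      (G₀.neighborSet b).ncard = k + 1 := by
    intro a b hab ha
    by_contra hb
    have hb : (G₀.neighborSet b).ncard = k + 2 := (hG₀ b).resolve_left hb
    have hne : a ≠ b := hab.ne
    have key : ∀ v, ((G₀.deleteEdges {s(a, b)}).neighborSet v).ncard = k + 1 ∨
        ((G₀.deleteEdges {s(a, b)}).neighborSet v).ncard = k + 2 := by
      intro v
      by_cases hva : v = a
      · subst hva
        have : (G₀.deleteEdges {s(v, b)}).neighborSet v = G₀.neighborSet v \ {b} := by
          ext u; simp [hne]
        rw [this, Set.ncard_sdiff_singleton_of_mem (by simpa using hab)]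
        left; omega
      by_cases hvb : v = b
      · subst hvb
        have : (G₀.deleteEdges {s(a, v)}).neighborSet v = G₀.neighborSet v \ {a} := by
          ext u; simp [hne.symm]
        rw [this, Set.ncard_sdiff_singleton_of_mem (by simpa using hab.symm)]
        left; omega
      · have : (G₀.deleteEdges {s(a, b)}).neighborSet v = G₀.neighborSet v := by
          ext u; simp [hva, hvb]
        rw [this]; exact hG₀ v
    have := hmin.le_of_le key (deleteEdges_le _) hab
    simp at this
  let T := {v // (G₀.neighborSet v).ncard = k + 2}
  have hdeg : ∀ v, (G₀.neighborSet v).ncard = (G₀.neighborFinset v).card := by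
    intro v; rw [← Set.ncard_coe_finset, coe_neighborFinset]
  obtain ⟨m, hminj, hm⟩ := (Finset.all_card_le_biUnion_card_iff_exists_injective
    (fun a : T => G₀.neighborFinset a)).1 (by
    intro S
    have h := Finset.sum_card_bipartiteAbove_eq_sum_card_bipartiteBelow
      (fun (a : T) b => G₀.Adj a b)
      (s := S) (t := S.biUnion fun a => G₀.neighborFinset a)
    have h1 : ∑ a ∈ S, (Finset.bipartiteAbove (fun (a : T) b => G₀.Adj a b)
        (S.biUnion fun a => G₀.neighborFinset a) a).card = S.card * (k + 2) := by
      apply Finset.sum_const_nat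
      intro a ha
      refine Eq.trans ?_ ((hdeg a).symm.trans a.2)
      congr 1
      ext b
      simp only [Finset.mem_bipartiteAbove, Finset.mem_biUnion, mem_neighborFinset,
        and_iff_right_iff_imp]
      exact fun hb => ⟨a, ha, hb⟩
    have h2 : ∑ b ∈ S.biUnion fun a => G₀.neighborFinset a,
        (Finset.bipartiteBelow (fun (a : T) b => G₀.Adj a b) S b).card ≤
        (S.biUnion fun a => G₀.neighborFinset a).card * (k + 1) := by
      apply Finset.sum_le_card_nsmul
      intro b hb
      obtain ⟨a, ha, hab⟩ := Finset.mem_biUnion.1 hb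
      rw [← hdel a b (by simpa using hab) a.2, hdeg]
      refine Finset.card_le_card_of_injOn Subtype.val ?_ Subtype.val_injective.injOn
      intro c hc
      simpa [adj_comm] using ((Finset.mem_bipartiteBelow _).1 hc).2
    have h3 := (h1.symm.trans h).trans_le h2
    nlinarith)
  have hm' : ∀ a : T, G₀.Adj a (m a) := fun a => by simpa using hm a
  have hmT : ∀ a : T, (G₀.neighborSet (m a)).ncard = k + 1 := fun a => hdel a _ (hm' a) a.2
  let M : Set (Sym2 V) := Set.range fun a : T => s((a : V), m a)
  refine ⟨G₀.deleteEdges M, (deleteEdges_le _).trans hle, fun v => ?_⟩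
  by_cases hv : (G₀.neighborSet v).ncard = k + 2
  · have : (G₀.deleteEdges M).neighborSet v = G₀.neighborSet v \ {m ⟨v, hv⟩} := by
      ext u
      simp only [mem_neighborSet, deleteEdges_adj, Set.mem_sdiff, Set.mem_singleton_iff, M,
        Set.mem_range, and_congr_right_iff, not_iff_not]
      intro hu
      constructor
      · rintro ⟨a, ha⟩
        rcases Sym2.eq_iff.1 ha with ⟨h1, h2⟩ | ⟨h1, h2⟩
        · rw [← h2]; congr; exact Subtype.ext h1
        · have := hmT a
          rw [h2] at this; omega
      · rintro rfl
        exact ⟨⟨v, hv⟩, rfl⟩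
    rw [this, Set.ncard_sdiff_singleton_of_mem (by simpa using hm' ⟨v, hv⟩)]
    right; omega
  · have hv1 := (hG₀ v).resolve_right hv
    by_cases hex : ∃ a, m a = v
    · obtain ⟨a, rfl⟩ := hex
      have : (G₀.deleteEdges M).neighborSet (m a) = G₀.neighborSet (m a) \ {(a : V)} := by
        ext u
        simp only [mem_neighborSet, deleteEdges_adj, Set.mem_sdiff, Set.mem_singleton_iff, M,
          Set.mem_range, and_congr_right_iff, not_iff_not]
        intro hu
        constructor
        · rintro ⟨b, hb⟩
          rcases Sym2.eq_iff.1 hb with ⟨h1, h2⟩ | ⟨h1, h2⟩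
          · exact absurd (h1 ▸ b.2) hv
          · rw [← h1, hminj h2]
        · rintro rfl
          exact ⟨a, Sym2.eq_swap⟩
      rw [this, Set.ncard_sdiff_singleton_of_mem (by simpa using (hm' a).symm)]
      left; omega
    · have : (G₀.deleteEdges M).neighborSet v = G₀.neighborSet v := by
        ext u
        simp only [mem_neighborSet, deleteEdges_adj, M, Set.mem_range, and_iff_left_iff_imp]
        rintro hu ⟨b, hb⟩
        rcases Sym2.eq_iff.1 hb with ⟨h1, h2⟩ | ⟨h1, h2⟩
        · exact hv (h1 ▸ b.2)
        · exact hex ⟨b, h2⟩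
      rw [this]; exact Or.inr hv1

/-- A regular graph has a spanning subgraph with all degrees in `{k, k + 1}`, for every `k` up to
its degree. -/
theorem SimpleGraph.exists_le_ncard_neighborSet_eq_or_succ {V : Type*} [Finite V]
    (G : SimpleGraph V) (k j : ℕ) (hG : ∀ v, (G.neighborSet v).ncard = k + j) :
    ∃ G' ≤ G, ∀ v, (G'.neighborSet v).ncard = k ∨ (G'.neighborSet v).ncard = k + 1 := by
  suffices h : ∀ j k, (∀ v, (G.neighborSet v).ncard = k + j) →
      ∃ G' ≤ G, ∀ v, (G'.neighborSet v).ncard = k ∨ (G'.neighborSet v).ncard = k + 1 from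
    h j k hG
  intro j
  induction j with
  | zero => exact fun k h => ⟨G, le_rfl, fun v => Or.inl (h v)⟩
  | succ j ih =>
    intro k h
    obtain ⟨G₁, h₁, hG₁⟩ := ih (k + 1) fun v => by rw [h v]; ring
    obtain ⟨G₂, h₂, hG₂⟩ := G₁.exists_le_ncard_neighborSet_pred k hG₁
    exact ⟨G₂, h₂.trans h₁, hG₂⟩

theorem AddMonoidHom.card_filter_eq_zero_mul_card {A B : Type*} [AddCommGroup A] [AddCommGroup B]
    [Fintype A] [Fintype B] [DecidableEq B] (φ : A →+ B) (hφ : Function.Surjective φ) :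
    (Finset.univ.filter fun a => φ a = 0).card * Fintype.card B = Fintype.card A := by
  have h := AddSubgroup.card_eq_card_quotient_mul_card_addSubgroup φ.ker
  rw [Nat.card_congr (QuotientAddGroup.quotientKerEquivOfSurjective φ hφ).toEquiv,
    Nat.card_eq_fintype_card, Nat.card_eq_fintype_card, Nat.card_eq_fintype_card,
    Fintype.card_subtype] at h
  rw [h, mul_comm]
  simp only [AddMonoidHom.mem_ker]

/-- Union bound over the possible linear relations for a random family to be dependent. -/
theorem card_filter_not_linearIndependent_mul_le {E K M : Type*} [Fintype E] [DecidableEq E]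
    [Field K] [Fintype K]    [AddCommGroup M] [Fintype M] [Module K M] (D : Set E)
    [DecidablePred fun f : E → M => ¬ LinearIndependent K fun e : D => f e] :
    (Finset.univ.filter fun f : E → M => ¬ LinearIndependent K fun e : D => f e).card *
      Fintype.card M ≤ Fintype.card K ^ D.ncard * Fintype.card (E → M) := by
  classical
  let φ : (D → K) → (E → M) →+ M := fun g =>
    { toFun := fun f => ∑ e, g e • f e
      map_zero' := by simp
      map_add' := fun f f' => by simp [Finset.sum_add_distrib] }
  have hφ : ∀ g ≠ 0, Function.Surjective (φ g) := by
    intro g hg x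
    obtain ⟨e, he⟩ := Function.ne_iff.1 hg
    refine ⟨Pi.single (e : E) ((g e)⁻¹ • x), ?_⟩
    have he : g e ≠ 0 := he
    change ∑ e', g e' • (Pi.single (e : E) ((g e)⁻¹ • x) : E → M) e' = x
    rw [Finset.sum_eq_single e]
    · simp [smul_smul, he]
    · intro b _ hb
      rw [Pi.single_eq_of_ne (fun h => hb (Subtype.ext h)), smul_zero]
    · simp
  have hsub : (Finset.univ.filter fun f : E → M => ¬ LinearIndependent K fun e : D => f e) ⊆
      (Finset.univ.filter fun g : D → K => g ≠ 0).biUnion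
        fun g => Finset.univ.filter fun f => φ g f = 0 := by
    intro f hf
    rw [Finset.mem_filter, Fintype.not_linearIndependent_iff] at hf
    obtain ⟨-, g, hg, i, hi⟩ := hf
    simp only [Finset.mem_biUnion, Finset.mem_filter, Finset.mem_univ, true_and]
    exact ⟨g, fun h => hi (by simp [h]), hg⟩
  calc
    _ ≤ (∑ g : D → K with g ≠ 0, (Finset.univ.filter fun f => φ g f = 0).card) *
        Fintype.card M :=
      Nat.mul_le_mul_right _ ((Finset.card_le_card hsub).trans Finset.card_biUnion_le)
    _ = ∑ g : D → K with g ≠ 0, Fintype.card (E → M) := by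
      rw [Finset.sum_mul]
      refine Finset.sum_congr rfl fun g hg => ?_
      exact (φ g).card_filter_eq_zero_mul_card (hφ g (Finset.mem_filter.1 hg).2)
    _ ≤ _ := by
      rw [Finset.sum_const, smul_eq_mul]
      refine Nat.mul_le_mul_right _ ((Finset.card_filter_le _ _).trans_eq ?_)
      rw [Finset.card_univ, Fintype.card_fun, ← Nat.card_coe_set_eq, Nat.card_eq_fintype_card]

/-- Union bound over the hyperplanes for a random family not to span. -/
theorem card_filter_span_image_ne_top_mul_le {E K ι : Type*} [Fintype E] [Field K] [Fintype K]
    [Fintype ι] [DecidableEq ι] [DecidableEq E] (D : Set E)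
    [DecidablePred fun f : E → ι → K => Submodule.span K (f '' D) ≠ ⊤] :
    (Finset.univ.filter fun f : E → ι → K => Submodule.span K (f '' D) ≠ ⊤).card *
      Fintype.card K ^ D.ncard ≤ Fintype.card K ^ Fintype.card ι * Fintype.card (E → ι → K) := by
  classical
  let φ : (ι → K) → (E → ι → K) →+ (D → K) := fun c =>
    { toFun := fun f e => c ⬝ᵥ f e
      map_zero' := by ext; simp
      map_add' := fun f f' => by ext; simp [dotProduct_add] }
  have hφ : ∀ c ≠ 0, Function.Surjective (φ c) := by
    intro c hc x
    obtain ⟨i, hi⟩ := Function.ne_iff.1 hc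
    have hi : c i ≠ 0 := hi
    refine ⟨fun e => if h : e ∈ D then Pi.single i ((c i)⁻¹ * x ⟨e, h⟩) else 0, ?_⟩
    ext e
    change c ⬝ᵥ (if h : (e : E) ∈ D then _ else _) = _
    simp [hi]
  have hsub : (Finset.univ.filter fun f : E → ι → K => Submodule.span K (f '' D) ≠ ⊤) ⊆
      (Finset.univ.filter fun c : ι → K => c ≠ 0).biUnion
        fun c => Finset.univ.filter fun f => φ c f = 0 := by
    intro f hf
    obtain ⟨p, hp, hle⟩ := Submodule.exists_le_ker_of_lt_top _
      (lt_top_iff_ne_top.2 (Finset.mem_filter.1 hf).2)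
    have hdot : ∀ x, (fun i => p (Pi.single i 1)) ⬝ᵥ x = p x := by
      intro x
      conv_rhs => rw [pi_eq_sum_univ' x]
      simp [dotProduct, mul_comm]
    simp only [Finset.mem_biUnion, Finset.mem_filter, Finset.mem_univ, true_and]
    refine ⟨fun i => p (Pi.single i 1), fun h => hp ?_, ?_⟩
    · ext i; simpa using congrFun h i
    · ext e
      exact (hdot _).trans (hle (Submodule.subset_span ⟨e, e.2, rfl⟩))
  have hcard : Fintype.card (D → K) = Fintype.card K ^ D.ncard := by
    rw [Fintype.card_fun, ← Nat.card_coe_set_eq, Nat.card_eq_fintype_card]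
  calc
    _ ≤ (∑ c : ι → K with c ≠ 0, (Finset.univ.filter fun f => φ c f = 0).card) *
        Fintype.card (D → K) := by
      rw [hcard]
      exact Nat.mul_le_mul_right _ ((Finset.card_le_card hsub).trans Finset.card_biUnion_le)
    _ = ∑ c : ι → K with c ≠ 0, Fintype.card (E → ι → K) := by
      rw [Finset.sum_mul]
      refine Finset.sum_congr rfl fun g hg => ?_
      exact (φ g).card_filter_eq_zero_mul_card (hφ g (Finset.mem_filter.1 hg).2)
    _ ≤ _ := by
      rw [Finset.sum_const, smul_eq_mul]
      refine Nat.mul_le_mul_right _ ((Finset.card_filter_le _ _).trans_eq ?_)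
      rw [Finset.card_univ, Fintype.card_fun]

/-- The vertex sets of the walks of length `n` starting at `v`. -/
def SimpleGraph.walkRanges {V : Type*} [DecidableEq V] (G : SimpleGraph V) [G.LocallyFinite] :
    ℕ → V → Finset (Finset V)
  | 0, v => {{v}}
  | n + 1, v => (G.neighborFinset v).biUnion fun u => (G.walkRanges n u).image (insert v)

theorem SimpleGraph.Walk.toFinset_support_mem_walkRanges {V : Type*} [DecidableEq V]
    {G : SimpleGraph V} [G.LocallyFinite] {u v : V} (p : G.Walk u v) :
    p.support.toFinset ∈ G.walkRanges p.length u := by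
  induction p with
  | nil => simp [walkRanges]
  | cons h p ih =>
    simp only [walkRanges, length_cons, Finset.mem_biUnion, mem_neighborFinset, Finset.mem_image]
    exact ⟨_, h, _, ih, by simp⟩

theorem SimpleGraph.card_walkRanges_le {V : Type*} [DecidableEq V] (G : SimpleGraph V)
    [G.LocallyFinite] {d : ℕ} (hG : ∀ v, G.degree v ≤ d) (n : ℕ) (v : V) :
    (G.walkRanges n v).card ≤ d ^ n := by
  induction n generalizing v with
  | zero => simp [walkRanges]
  | succ n ih =>
    rw [walkRanges, pow_succ']
    refine (Finset.card_biUnion_le_card_mul _ _ (d ^ n) fun u _ =>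
      Finset.card_image_le.trans (ih u)).trans (Nat.mul_le_mul_right _ ?_)
    exact hG v

/-- A connected vertex set is the range of a closed walk running twice along the edges of a
spanning tree. -/
theorem SimpleGraph.exists_walk_of_connected_induce {V : Type*} [DecidableEq V] {G : SimpleGraph V}
    {W : Finset V} (hW : (G.induce (W : Set V)).Connected) {v : V} (hv : v ∈ W) :
    ∃ p : G.Walk v v, p.support.toFinset = W ∧ p.length = 2 * (W.card - 1) := by
  have key : ∀ n < W.card, ∃ p : G.Walk v v, p.support.toFinset ⊆ W ∧
      p.support.toFinset.card = n + 1 ∧ p.length = 2 * n := by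
    intro n
    induction n with
    | zero => exact fun _ => ⟨.nil, by simpa using hv, by simp, by simp⟩
    | succ n ih =>
      intro hn
      obtain ⟨p, hpW, hpc, hpl⟩ := ih (by omega)
      obtain ⟨w, hwW, hwp⟩ : ∃ w ∈ W, w ∉ p.support.toFinset := by
        by_contra! h
        have := Finset.card_le_card (show W ⊆ _ from h)
        omega
      obtain ⟨q⟩ := hW.preconnected ⟨v, hv⟩ ⟨w, hwW⟩
      obtain ⟨⟨⟨a, b⟩, hab⟩, -, ha, hb⟩ := q.exists_boundary_dart
        {x | (x : V) ∈ p.support} (by simp) (by simpa using hwp)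
      have hab : G.Adj a b := hab
      let r : G.Walk v v :=
        (p.takeUntil a ha).append (.cons hab (.cons hab.symm (p.dropUntil a ha)))
      have hr : r.support.toFinset = insert (b : V) p.support.toFinset := by
        ext x
        have : x ∈ p.support ↔ x ∈ (p.takeUntil a ha).support ∨ x ∈ (p.dropUntil a ha).support := by
          conv_lhs => rw [← p.take_spec ha]
          exact Walk.mem_support_append_iff _ _
        have h2 := (p.takeUntil a ha).end_mem_support
        have h3 := (p.dropUntil a ha).start_mem_support
        simp only [r, List.mem_toFinset, Walk.mem_support_append_iff, Walk.support_cons,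
          List.mem_cons, Finset.mem_insert, this]
        grind
      refine ⟨r, ?_, ?_, ?_⟩
      · rw [hr]
        exact Finset.insert_subset b.2 hpW
      · rw [hr, Finset.card_insert_of_notMem (by simpa using hb), hpc]
      · have := congrArg Walk.length (p.take_spec ha)
        simp only [Walk.length_append] at this
        simp only [r, Walk.length_append, Walk.length_cons]
        omega
  have hpos : 0 < W.card := Finset.card_pos.2 ⟨v, hv⟩
  obtain ⟨p, h1, h2, h3⟩ := key (W.card - 1) (by omega)
  exact ⟨p, Finset.eq_of_subset_of_card_le h1 (by omega), h3⟩

theorem SimpleGraph.card_connected_induce_le {V : Type*} [DecidableEq V] (G : SimpleGraph V)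
    [G.LocallyFinite] {d : ℕ} (hG : ∀ v, G.degree v ≤ d) (v : V) (w : ℕ) (J : Finset (Finset V))
    (hJ : ∀ W ∈ J, (G.induce (W : Set V)).Connected ∧ v ∈ W ∧ W.card = w) :
    J.card ≤ d ^ (2 * (w - 1)) := by
  refine (Finset.card_le_card fun W hW => ?_).trans (G.card_walkRanges_le hG (2 * (w - 1)) v)
  obtain ⟨hc, hv, rfl⟩ := hJ W hW
  obtain ⟨p, h1, h2⟩ := exists_walk_of_connected_induce hc hv
  have h := p.toFinset_support_mem_walkRanges
  rwa [h1, h2] at h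

theorem SimpleGraph.sum_pow_card_connected_induce_le {V : Type*} [DecidableEq V]
    (G : SimpleGraph V) [G.LocallyFinite] {d : ℕ} (hd : 0 < d) (hG : ∀ v, G.degree v ≤ d) (v : V)
    (J : Finset (Finset V)) (hJ : ∀ W ∈ J, (G.induce (W : Set V)).Connected ∧ v ∈ W) :
    ∑ W ∈ J, (1 / (4 * (d : ℝ) ^ 2)) ^ W.card ≤ 1 / (3 * (d : ℝ) ^ 2) := by
  have hd' : (0 : ℝ) < d := by exact_mod_cast hd
  have hmaps : ∀ W ∈ J, W.card - 1 ∈ Finset.range (J.sup Finset.card) := by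
    intro W hW
    have h1 := Finset.le_sup (f := Finset.card) hW
    have h2 := Finset.card_pos.2 ⟨v, (hJ W hW).2⟩
    rw [Finset.mem_range]; omega
  rw [← Finset.sum_fiberwise_of_maps_to hmaps]
  calc
    _ ≤ ∑ n ∈ Finset.range (J.sup Finset.card), 1 / (4 * (d : ℝ) ^ 2) * (1 / 4) ^ n := by
      refine Finset.sum_le_sum fun n _ => ?_
      have hcard : ∀ W ∈ J.filter (fun W => W.card - 1 = n), W.card = n + 1 := by
        intro W hW
        obtain ⟨hW, h⟩ := Finset.mem_filter.1 hW
        have := Finset.card_pos.2 ⟨v, (hJ W hW).2⟩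
        omega
      rw [Finset.sum_congr rfl fun W hW => by rw [hcard W hW], Finset.sum_const, nsmul_eq_mul]
      have h := G.card_connected_induce_le hG v (n + 1) (J.filter fun W => W.card - 1 = n)
        fun W hW => ⟨(hJ W (Finset.mem_filter.1 hW).1).1, (hJ W (Finset.mem_filter.1 hW).1).2,
          hcard W hW⟩
      have h : ((J.filter fun W => W.card - 1 = n).card : ℝ) ≤ (d : ℝ) ^ (2 * n) := by
        exact_mod_cast h
      calc
        _ ≤ (d : ℝ) ^ (2 * n) * (1 / (4 * (d : ℝ) ^ 2)) ^ (n + 1) := by gcongr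
        _ = _ := by
          rw [pow_succ (1 / (4 * (d : ℝ) ^ 2)), pow_mul, ← mul_assoc, ← mul_pow, mul_comm]
          congr 2
          field_simp
    _ = 1 / (4 * (d : ℝ) ^ 2) * ∑ n ∈ Finset.range (J.sup Finset.card), (1 / 4 : ℝ) ^ n := by
      rw [Finset.mul_sum]
    _ ≤ 1 / (4 * (d : ℝ) ^ 2) * (4 / 3) := by
      gcongr
      rw [geom_sum_eq (by norm_num), div_le_iff_of_neg (by norm_num)]
      have : (0 : ℝ) < (1 / 4) ^ (J.sup Finset.card) := by positivity
      linarith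
    _ = _ := by field_simp

theorem logb_two_le_div_fifty {d : ℝ} (hd : 1000 ≤ d) : Real.logb 2 d ≤ d / 50 := by
  have h0 : (0 : ℝ) < d := by linarith
  have h2 : (0.69 : ℝ) < Real.log 2 := by linarith [Real.log_two_gt_d9]
  have h3 : Real.log d = Real.log (d / 1024) + 10 * Real.log 2 := by
    rw [Real.log_div h0.ne' (by norm_num), show (1024 : ℝ) = 2 ^ 10 by norm_num, Real.log_pow]
    push_cast; ring
  have h4 := Real.log_le_sub_one_of_pos (show 0 < d / 1024 by positivity)
  rw [Real.logb, div_le_iff₀ (by linarith), h3]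
  nlinarith

theorem two_pow_mul_pow_le {d w m k : ℕ} (hd : 1000 ≤ d) (hw : 2 ≤ w)
    (hk : (k : ℝ) ≤ 3 * Real.logb 2 d + 2)
    (h1 : (w : ℝ) * (8 * Real.logb 2 d + 2) ≤ m + w * k)
    (h2 : (w : ℝ) * (d + 1) ≤ m + w * k + w * w) :
    (2 : ℝ) ^ d * (8 * (d : ℝ) ^ 2) ^ w ≤ 2 ^ m := by
  have hd' : (1000 : ℝ) ≤ d := by exact_mod_cast hd
  have hw' : (2 : ℝ) ≤ w := by exact_mod_cast hw
  have hL := logb_two_le_div_fifty hd'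
  set L := Real.logb 2 d with hLdef
  have hL9 : 9 ≤ L := by
    rw [hLdef, Real.le_logb_iff_rpow_le (by norm_num) (by linarith)]
    norm_num; linarith
  have hdL : (8 * (d : ℝ) ^ 2) = (2 : ℝ) ^ (3 + 2 * L) := by
    rw [Real.rpow_add (by norm_num), mul_comm 2 L, Real.rpow_mul (by norm_num), hLdef,
      Real.rpow_logb (by norm_num) (by norm_num) (by linarith)]
    norm_num
  rw [hdL, ← Real.rpow_natCast _ w, ← Real.rpow_mul (by norm_num), ← Real.rpow_natCast _ d,
    ← Real.rpow_natCast _ m, ← Real.rpow_add (by norm_num)]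
  refine Real.rpow_le_rpow_of_exponent_le (by norm_num) ?_
  have hwk : (w : ℝ) * k ≤ w * (3 * L + 2) := by gcongr
  by_cases hwd : (d : ℝ) ≤ w * (3 * L - 3)
  · nlinarith
  · push Not at hwd
    have : (w : ℝ) * 24 ≤ w * (3 * L - 3) := by gcongr; linarith
    have h3 : (d : ℝ) / 2 ≤ d - w - 5 * L - 4 := by linarith
    have h4 : (2 : ℝ) * (d / 2) ≤ w * (d - w - 5 * L - 4) := by gcongr
    nlinarith

theorem ncard_cutEdgeSet {V : Type*} [Finite V] (G : SimpleGraph V) (W : Finset V) :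
    (cutEdgeSet G W).ncard = ∑ u ∈ W, (G.neighborSet u \ W).ncard := by
  classical
  have := Fintype.ofFinite V
  have hset : cutEdgeSet G W = ((W.sigma fun u => G.neighborFinset u \ W).image
      fun p => s(p.1, p.2) : Finset (Sym2 V)) := by
    ext e
    simp only [cutEdgeSet, Set.mem_ofPred_eq, Finset.coe_image, Set.mem_image, Finset.mem_coe,
      Finset.mem_sigma, Finset.mem_sdiff, mem_neighborFinset, Set.mem_compl_iff]
    constructor
    · rintro ⟨he, x, hx, y, hy, rfl⟩
      exact ⟨⟨x, y⟩, ⟨hx, he, hy⟩, rfl⟩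
    · rintro ⟨⟨x, y⟩, ⟨hx, he, hy⟩, rfl⟩
      exact ⟨he, x, hx, y, hy, rfl⟩
  rw [hset, Set.ncard_coe_finset, Finset.card_image_of_injOn, Finset.card_sigma]
  · refine Finset.sum_congr rfl fun u _ => ?_
    rw [← Set.ncard_coe_finset, Finset.coe_sdiff, coe_neighborFinset]
  · rintro ⟨a, b⟩ h ⟨a', b'⟩ h' heq
    simp only [Finset.mem_coe, Finset.mem_sigma, Finset.mem_sdiff] at h h'
    rcases Sym2.eq_iff.1 heq with ⟨h1, h2⟩ | ⟨h1, h2⟩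
    · dsimp only at h1 h2; subst h1 h2; rfl
    · dsimp only at h1 h2; subst h1 h2; exact absurd h.1 h'.2.2

theorem ncard_cutEdgeSet_singleton {V : Type*} [Finite V] (G : SimpleGraph V) (u : V) :
    (cutEdgeSet G {u}).ncard = (G.neighborSet u).ncard := by
  have h := ncard_cutEdgeSet G {u}
  rw [Finset.coe_singleton, Finset.sum_singleton] at h
  rw [h, Set.sdiff_singleton_eq_self (by simp)]

theorem cutEdgeSet_singleton {V : Type*} (G : SimpleGraph V) (u : V) :
    cutEdgeSet G {u} = G.incidenceSet u := by
  ext e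
  induction e with | _ x y
  simp only [cutEdgeSet, incidenceSet, Set.mem_ofPred_eq, mem_edgeSet, Set.mem_singleton_iff,
    Set.mem_compl_iff, exists_eq_left, Sym2.mem_iff, Sym2.eq_iff, and_congr_right_iff]
  intro h
  constructor
  · rintro ⟨z, -, ⟨rfl, -⟩ | ⟨-, rfl⟩⟩ <;> simp
  · rintro (rfl | rfl)
    · exact ⟨y, h.ne', by simp⟩
    · exact ⟨x, h.ne, by simp⟩

theorem ncard_cutEdgeSet_le_of_le {V : Type*} [Finite V] {G G' : SimpleGraph V} (hle : G' ≤ G)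
    {k : ℕ} (hk : ∀ v, (G.neighborSet v).ncard ≤ (G'.neighborSet v).ncard + k) (W : Finset V) :
    (cutEdgeSet G W).ncard ≤ (cutEdgeSet G' W).ncard + W.card * k := by
  rw [ncard_cutEdgeSet, ncard_cutEdgeSet, ← smul_eq_mul, ← Finset.sum_const,
    ← Finset.sum_add_distrib]
  refine Finset.sum_le_sum fun u _ => ?_
  have hsub : G'.neighborSet u ⊆ G.neighborSet u := fun _ h => hle h
  have h1 := Set.ncard_sdiff_add_ncard_of_subset hsub
  have h2 : (G.neighborSet u \ W) ⊆
      (G'.neighborSet u \ W) ∪ (G.neighborSet u \ G'.neighborSet u) := by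
    intro x; simp only [Set.mem_sdiff, Set.mem_union]; tauto
  have h3 := (Set.ncard_le_ncard h2).trans (Set.ncard_union_le _ _)
  have := hk u
  omega

theorem card_mul_le_ncard_cutEdgeSet_add {V : Type*} [Finite V] {G : SimpleGraph V} {d : ℕ}
    (hd : ∀ v, d ≤ (G.neighborSet v).ncard) (W : Finset V) :
    W.card * (d + 1) ≤ (cutEdgeSet G W).ncard + W.card * W.card := by
  rw [ncard_cutEdgeSet]
  conv_rhs => rw [← smul_eq_mul W.card, ← Finset.sum_const, ← Finset.sum_add_distrib]
  rw [← smul_eq_mul, ← Finset.sum_const]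
  refine Finset.sum_le_sum fun u hu => ?_
  have h1 : insert u (G.neighborSet u) ⊆ (G.neighborSet u \ W) ∪ W := by
    intro x hx
    rcases hx with rfl | hx
    · exact Or.inr hu
    · by_cases x ∈ W <;> simp_all
  have h2 := (Set.ncard_le_ncard h1).trans (Set.ncard_union_le _ _)
  rw [Set.ncard_insert_of_notMem (by simp), Set.ncard_coe_finset] at h2
  have := hd u
  omega

theorem two_pow_sub_mul_le {d t k : ℕ} (hd : 1000 ≤ d) (hk : 3 * Real.logb 2 d ≤ k)
    (ht : t + k ≤ d) : (2 : ℝ) ^ t * (8 * (d : ℝ) ^ 2) ≤ 2 ^ d := by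
  have hd' : (1000 : ℝ) ≤ d := by exact_mod_cast hd
  have h : (d : ℝ) ^ 3 ≤ 2 ^ k := by
    calc
      _ = (2 : ℝ) ^ (3 * Real.logb 2 d) := by
        rw [mul_comm, Real.rpow_mul (by norm_num),
          Real.rpow_logb (by norm_num) (by norm_num) (by linarith)]
        norm_num
      _ ≤ (2 : ℝ) ^ (k : ℝ) := Real.rpow_le_rpow_of_exponent_le (by norm_num) hk
      _ = _ := Real.rpow_natCast _ _
  calc
    _ ≤ (2 : ℝ) ^ t * 2 ^ k := by gcongr; nlinarith [sq_nonneg (d : ℝ)]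
    _ = (2 : ℝ) ^ (t + k) := (pow_add _ _ _).symm
    _ ≤ _ := pow_le_pow_right₀ (by norm_num) ht

/-- A product form of `1 - x ≥ exp (-2 x)`. -/
theorem exp_neg_le_prod_one_sub {ι : Type*} (s : Finset ι) (x : ι → ℝ)
    (h0 : ∀ i ∈ s, 0 ≤ x i) (h1 : ∀ i ∈ s, x i ≤ 1 / 2) :
    Real.exp (-(2 * ∑ i ∈ s, x i)) ≤ ∏ i ∈ s, (1 - x i) := by
  rw [Finset.mul_sum, ← Finset.sum_neg_distrib, Real.exp_sum]
  refine Finset.prod_le_prod (fun i _ => (Real.exp_pos _).le) fun i hi => ?_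
  have h2 := Real.add_one_le_exp (2 * x i)
  have h3 := h0 i hi
  have h4 := h1 i hi
  rw [Real.exp_neg, inv_le_iff_one_le_mul₀ (Real.exp_pos _)]
  nlinarith

/-- The bad events `A W`, indexed by connected sets `W` and determined by the labels of the edges
leaving `W`, can be avoided as soon as their probabilities decay fast enough. -/
theorem exists_forall_not_of_card_le {V S : Type*} [Fintype V] [DecidableEq V] [Fintype S]
    [Nonempty S] {H H' : SimpleGraph V} [H.LocallyFinite] [Fintype H'.edgeSet] (hle : H' ≤ H)
    {d : ℕ} (hd : 8 ≤ d) (hH : ∀ v, H.degree v ≤ d) (J : Finset (Finset V))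
    (hJ : ∀ W ∈ J, (H.induce (W : Set V)).Connected)
    (A : Finset V → (H'.edgeSet → S) → Prop) [∀ W, DecidablePred (A W)]
    (hA : ∀ W ∈ J, ∀ f g : H'.edgeSet → S,
      (∀ e : H'.edgeSet, (e : Sym2 V) ∈ cutEdgeSet H' W → f e = g e) → A W f → A W g)
    (hprob : ∀ W ∈ J, ((Finset.univ.filter (A W)).card : ℝ) * (8 * (d : ℝ) ^ 2) ^ W.card ≤
      Fintype.card (H'.edgeSet → S)) :
    ∃ f, ∀ W ∈ J, ¬ A W f := by
  classical
  have hd' : (8 : ℝ) ≤ d := by exact_mod_cast hd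
  set y : ℝ := 1 / (4 * (d : ℝ) ^ 2) with hy
  have hy0 : 0 < y := by positivity
  have hy1 : y ≤ 1 / 4 := by
    rw [hy]; exact one_div_le_one_div_of_le (by norm_num) (by nlinarith)
  have hx : ∀ W ∈ J, y ^ W.card ≤ 1 / 4 := by
    intro W hW
    have hW0 : W.card ≠ 0 := by
      obtain ⟨v, hv⟩ := (hJ W hW).nonempty
      exact (Finset.card_pos.2 ⟨v, hv⟩).ne'
    exact (pow_le_of_le_one hy0.le (by linarith) hW0).trans hy1
  let D : Finset V → Set H'.edgeSet := fun W => {e | (e : Sym2 V) ∈ cutEdgeSet H' W}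
  refine lovasz_local_lemma J A D hA (fun W => y ^ W.card) (fun W _ => by positivity)
    (fun W hW => (hx W hW).trans_lt (by norm_num)) fun W hW => ?_
  have hsum : ∑ U ∈ J with ¬ Disjoint (D W) (D U), y ^ U.card ≤ W.card * (1 / 4) := by
    let X : Finset V := W.biUnion fun u => insert u (H.neighborFinset u)
    have hmem : ∀ U ∈ J.filter fun U => ¬ Disjoint (D W) (D U), ∃ v ∈ X, v ∈ U := by
      intro U hU
      obtain ⟨e, ⟨he, a, ha, b, hb, hab⟩, ⟨-, a', ha', b', hb', hab'⟩⟩ :=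
        Set.not_disjoint_iff.1 (Finset.mem_filter.1 hU).2
      simp only [X, Finset.mem_biUnion, Finset.mem_insert, mem_neighborFinset]
      refine ⟨a', ⟨a, ha, ?_⟩, ha'⟩
      rw [hab] at he
      rcases Sym2.eq_iff.1 (hab.symm.trans hab') with ⟨h1, h2⟩ | ⟨h1, h2⟩
      · exact Or.inl h1.symm
      · exact Or.inr (h2 ▸ hle he)
    have hcard : (X.card : ℝ) ≤
        W.card * (d + 1) := by
      exact_mod_cast Finset.card_biUnion_le_card_mul _ _ (d + 1) fun u _ =>
        (Finset.card_insert_le _ _).trans (Nat.succ_le_succ (hH u))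
    calc
      _ ≤ ∑ U ∈ J with ¬ Disjoint (D W) (D U), ∑ v ∈ X, if v ∈ U then y ^ U.card else 0 := by
        refine Finset.sum_le_sum fun U hU => ?_
        obtain ⟨v, hv, hvU⟩ := hmem U hU
        refine le_trans ?_ (Finset.single_le_sum (fun v _ => by positivity) hv)
        rw [if_pos hvU]
      _ ≤ ∑ U ∈ J, ∑ v ∈ X, if v ∈ U then y ^ U.card else 0 :=
        Finset.sum_le_sum_of_subset_of_nonneg (Finset.filter_subset _ _) fun _ _ _ => by positivity
      _ = ∑ v ∈ X, ∑ U ∈ J with v ∈ U, y ^ U.card := by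
        rw [Finset.sum_comm]
        simp only [Finset.sum_filter]
      _ ≤ ∑ v ∈ X, 1 / (3 * (d : ℝ) ^ 2) :=
        Finset.sum_le_sum fun v _ => H.sum_pow_card_connected_induce_le (by omega) hH v _
          fun U hU => ⟨hJ U (Finset.mem_filter.1 hU).1, (Finset.mem_filter.1 hU).2⟩
      _ ≤ W.card * (d + 1) * (1 / (3 * (d : ℝ) ^ 2)) := by
        rw [Finset.sum_const, nsmul_eq_mul]
        gcongr
      _ ≤ _ := by
        rw [mul_assoc]
        gcongr
        rw [mul_one_div, div_le_div_iff₀ (by positivity) (by norm_num)]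
        nlinarith
  have hprod : (1 / 2 : ℝ) ^ W.card ≤
      ∏ U ∈ J with ¬ Disjoint (D W) (D U), (1 - y ^ U.card) := by
    calc
      _ ≤ Real.exp (-(1 / 2)) ^ W.card := by
        gcongr
        linarith [Real.add_one_le_exp (-(1 / 2) : ℝ)]
      _ = Real.exp (-(2 * (W.card * (1 / 4)))) := by
        rw [← Real.exp_nat_mul]; ring_nf
      _ ≤ Real.exp (-(2 * ∑ U ∈ J with ¬ Disjoint (D W) (D U), y ^ U.card)) := by gcongr
      _ ≤ _ := exp_neg_le_prod_one_sub _ _ (fun _ _ => by positivity) fun U hU =>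
          (hx U (Finset.mem_filter.1 hU).1).trans (by norm_num)
  calc
    _ ≤ (1 / (8 * (d : ℝ) ^ 2)) ^ W.card * Fintype.card (H'.edgeSet → S) := by
      rw [one_div, inv_pow, inv_mul_eq_div, le_div_iff₀ (by positivity)]
      exact hprob W hW
    _ = y ^ W.card * (1 / 2) ^ W.card * Fintype.card (H'.edgeSet → S) := by
      rw [← mul_pow, hy]
      congr 2
      ring
    _ ≤ _ := by gcongr

/-- **Lemma 2.4.** Let `H` be `d`-regular on `n` vertices, `d ≥ 1000`, and suppose every
vertex set `W` with `|W| ≤ n/2` inducing a connected subgraph of `H` sends at least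
`|W| (8 log₂ d + 2)` edges to its complement. Then there is a spanning subgraph `H'` of `H`
of minimum degree at least `d - 3 log₂ d - 2` and an assignment of vectors of `(ℤ/2)^d` to the
edges of `H'` such that (1) at every vertex the vectors on the incident edges of `H'` are
linearly independent, and (2) for every `W` with `2 ≤ |W| ≤ n/2` inducing a connected subgraph
of `H`, the vectors on the edges of `H'` leaving `W` span `(ℤ/2)^d`. -/
theorem stmt5 {V : Type*} [Fintype V] (H : SimpleGraph V) (d : ℕ) (hd : 1000 ≤ d)
    (hreg : ∀ v : V, (H.neighborSet v).ncard = d)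
    (hexp : ∀ W : Set V, 2 * W.ncard ≤ Fintype.card V → (H.induce W).Connected →
      (W.ncard : ℝ) * (8 * Real.logb 2 d + 2) ≤ (cutEdgeSet H W).ncard) :
    ∃ H' : SimpleGraph V, H' ≤ H ∧
      (∀ v : V, (d : ℝ) - 3 * Real.logb 2 d - 2 ≤ (H'.neighborSet v).ncard) ∧
      ∃ v : H'.edgeSet → (Fin d → ZMod 2),
        (∀ u : V, LinearIndependent (ZMod 2)
          (fun e : {e : H'.edgeSet // (e : Sym2 V) ∈ H'.incidenceSet u} => v e.1)) ∧
        (∀ W : Set V, 2 ≤ W.ncard → 2 * W.ncard ≤ Fintype.card V →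
          (H.induce W).Connected →
          Submodule.span (ZMod 2)
            (v '' {e : H'.edgeSet | (e : Sym2 V) ∈ cutEdgeSet H' W}) = ⊤) := by
  classical
  have hd' : (1000 : ℝ) ≤ d := by exact_mod_cast hd
  have hL := logb_two_le_div_fifty hd'
  have hL0 : 0 ≤ Real.logb 2 d := Real.logb_nonneg (by norm_num) (by linarith)
  set k : ℕ := ⌈3 * Real.logb 2 d⌉₊
  have hk1 : 3 * Real.logb 2 d ≤ k := Nat.le_ceil _
  have hk2 : (k : ℝ) < 3 * Real.logb 2 d + 1 := Nat.ceil_lt_add_one (by linarith)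
  have hkd : k + 1 ≤ d := by
    have : (k + 1 : ℝ) ≤ d := by linarith
    exact_mod_cast this
  obtain ⟨H', hle, hH'⟩ := H.exists_le_ncard_neighborSet_eq_or_succ (d - (k + 1)) (k + 1)
    fun v => by rw [hreg v]; omega
  refine ⟨H', hle, fun v => ?_, ?_⟩
  · have : d ≤ (H'.neighborSet v).ncard + (k + 1) := by have := hH' v; omega
    have : (d : ℝ) ≤ (H'.neighborSet v).ncard + (k + 1) := by exact_mod_cast this
    linarith
  let D : Finset V → Set H'.edgeSet := fun W => {e | (e : Sym2 V) ∈ cutEdgeSet H' W}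
  have hD : ∀ W, (D W).ncard = (cutEdgeSet H' (W : Set V)).ncard := by
    intro W
    rw [← Set.ncard_image_of_injective (D W) Subtype.val_injective]
    congr 1
    ext e
    simp only [D, Set.mem_image, Set.mem_ofPred_eq, Subtype.exists, exists_and_right,
      exists_eq_right]
    exact ⟨fun ⟨_, h⟩ => h, fun h => ⟨h.1, h⟩⟩
  let A : Finset V → (H'.edgeSet → Fin d → ZMod 2) → Prop := fun W f =>
    if W.card = 1 then ¬ LinearIndependent (ZMod 2) fun e : D W => f e
    else Submodule.span (ZMod 2) (f '' D W) ≠ ⊤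
  let J : Finset (Finset V) := Finset.univ.filter fun W => (H.induce (W : Set V)).Connected ∧
    (W.card = 1 ∨ 2 ≤ W.card ∧ 2 * W.card ≤ Fintype.card V)
  suffices h : ∃ f, ∀ W ∈ J, ¬ A W f by
    obtain ⟨f, hf⟩ := h
    refine ⟨f, fun u => ?_, fun W hW1 hW2 hWc => ?_⟩
    · have h := hf {u} (Finset.mem_filter.2 ⟨Finset.mem_univ _, ?_, Or.inl (by simp)⟩)
      · simp only [A, Finset.card_singleton, if_true, not_not] at h
        have hset : D {u} = {e : H'.edgeSet | (e : Sym2 V) ∈ H'.incidenceSet u} := by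
          simp only [D, Finset.coe_singleton, cutEdgeSet_singleton]
        rw [hset] at h
        exact h
      · rw [Finset.coe_singleton]
        have : Nonempty ({u} : Set V) := ⟨u, rfl⟩
        exact ⟨.of_subsingleton⟩
    · obtain ⟨W, rfl⟩ := W.toFinite.exists_finset_coe
      rw [Set.ncard_coe_finset] at hW1 hW2
      have h := hf W (Finset.mem_filter.2 ⟨Finset.mem_univ _, hWc, Or.inr ⟨hW1, hW2⟩⟩)
      simpa only [A, if_neg (show W.card ≠ 1 by omega), not_not] using h
  refine exists_forall_not_of_card_le (S := Fin d → ZMod 2) hle (d := d) (by omega)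
    (fun v => by rw [← hreg v, ← card_neighborFinset_eq_degree, ← Set.ncard_coe_finset,
      coe_neighborFinset]) J (fun W hW => (Finset.mem_filter.1 hW).2.1) A ?_ ?_
  · intro W _ f g hfg hf
    have h1 : (fun e : D W => f e) = fun e : D W => g e := funext fun e => hfg e e.2
    have h2 : f '' D W = g '' D W := Set.image_congr hfg
    simpa only [A, h1, h2] using hf
  · intro W hW
    obtain ⟨-, hWc, hW⟩ := Finset.mem_filter.1 hW
    have hS : Fintype.card (Fin d → ZMod 2) = 2 ^ d := by simp
    by_cases hW1 : W.card = 1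
    · obtain ⟨u, rfl⟩ := Finset.card_eq_one.1 hW1
      have h := card_filter_not_linearIndependent_mul_le (K := ZMod 2) (M := Fin d → ZMod 2)
        (D {u})
      rw [hD, Finset.coe_singleton, ncard_cutEdgeSet_singleton, hS, ZMod.card] at h
      have hnum := two_pow_sub_mul_le (t := (H'.neighborSet u).ncard) hd hk1
        (by have := hH' u; omega)
      simp only [A, Finset.card_singleton, if_true, pow_one]
      refine le_of_mul_le_mul_left ?_ (show (0 : ℝ) < 2 ^ (H'.neighborSet u).ncard by positivity)
      rw [← @Nat.cast_le ℝ] at h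
      push_cast at h
      refine le_trans ?_ h
      rw [mul_left_comm]
      gcongr
    · obtain ⟨hW2, hWn⟩ := hW.resolve_left hW1
      have h := card_filter_span_image_ne_top_mul_le (K := ZMod 2) (ι := Fin d) (D W)
      rw [hD, ZMod.card, Fintype.card_fin] at h
      have h1 := hexp W (by rwa [Set.ncard_coe_finset]) hWc
      rw [Set.ncard_coe_finset] at h1
      have h2 := ncard_cutEdgeSet_le_of_le hle (k := k + 1)
        (fun v => by have := hH' v; rw [hreg]; omega) W
      have h3 := card_mul_le_ncard_cutEdgeSet_add (G := H') (d := d - (k + 1))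
        (fun v => by have := hH' v; omega) W
      rw [← @Nat.cast_le ℝ] at h h2 h3
      push_cast [hkd] at h h2 h3
      have hnum := two_pow_mul_pow_le (w := W.card) (m := (cutEdgeSet H' (W : Set V)).ncard)
        (k := k + 1) hd hW2 (by push_cast; linarith) (by push_cast; linarith)
        (by push_cast; linarith)
      simp only [A, if_neg hW1]
      refine le_of_mul_le_mul_left ?_ (show (0 : ℝ) < 2 ^ d by positivity)
      refine le_trans ?_ h
      rw [mul_left_comm]
      gcongr
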